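/- (𝔸₁, ≤) is quasi bounded-complete: every nonempty subset A of 𝔸₁ that is bounded above for the perturbation order and such that for all x, y ∈ A, ‖αˣ − αʸ‖_{ℓ¹} ≥ |βˣ − βʸ|, admits a minimal upper bound in 𝔸₁. -/

import Mathlib

open scoped BigOperators

/-- A generalized affine form: an `ℓ¹` family of noise coefficients `α` together with a
perturbation coefficient `β`. -/
structure AffineForm where
  α : ℕ → ℝ
  β : ℝ
  hsum : Summable fun i => |α i|

namespace AffineForm

/-- `ℓ¹` distance between the `α`-parts of two forms. -/
noncomputable def distL (x y : AffineForm) : ℝ := ∑' i, |x.α i - y.α i|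

/-- `ℓ¹` norm of the `α`-part. -/
noncomputable def normA (x : AffineForm) : ℝ := ∑' i, |x.α i|

/-- Total deviation of the noise part (indices `i ≥ 1`). -/
noncomputable def dev (x : AffineForm) : ℝ := ∑' i, |x.α (i + 1)|

/-- The perturbation order: `x ≤ y` iff `‖αˣ - αʸ‖₁ ≤ βʸ - βˣ`. -/
def le (x y : AffineForm) : Prop := distL x y ≤ y.β - x.β

/-- Lower bound of the concretization. -/
noncomputable def lo (x : AffineForm) : ℝ := x.α 0 - dev x - x.β

/-- Upper bound of the concretization. -/
noncomputable def hi (x : AffineForm) : ℝ := x.α 0 + dev x + x.β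

/-- The concretization interval. -/
noncomputable def γ (x : AffineForm) : Set ℝ := Set.Icc (lo x) (hi x)

theorem memℓp_α (x : AffineForm) : Memℓp x.α 1 := by
  refine memℓp_gen ?_
  simpa using x.hsum

/-- The `α`-part of a form, as an element of `ℓ¹`. -/
def toL1 (x : AffineForm) : lp (fun _ : ℕ => ℝ) 1 := ⟨x.α, x.memℓp_α⟩

/-- The form with prescribed `α`-part in `ℓ¹` and prescribed `β`. -/
def ofL1 (f : lp (fun _ : ℕ => ℝ) 1) (r : ℝ) : AffineForm where
  α := f
  β := r
  hsum := by simpa using (lp.memℓp f).summable (by simp)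

theorem distL_eq_dist (x y : AffineForm) : distL x y = dist x.toL1 y.toL1 := by
  rw [dist_eq_norm, lp.norm_eq_tsum_rpow (by simp)]
  simp only [distL, toL1, ENNReal.toReal_one, Real.rpow_one, div_one]
  rfl

theorem le_iff (x y : AffineForm) : x.le y ↔ dist x.toL1 y.toL1 ≤ y.β - x.β := by
  rw [le, distL_eq_dist]

theorem toL1_ofL1 (f : lp (fun _ : ℕ => ℝ) 1) (r : ℝ) : (ofL1 f r).toL1 = f := rfl

theorem ofL1_toL1 (x : AffineForm) : ofL1 x.toL1 x.β = x := rfl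

theorem le_refl (x : AffineForm) : x.le x := by simp [le_iff]

theorem le_trans {x y z : AffineForm} (hxy : x.le y) (hyz : y.le z) : x.le z := by
  rw [le_iff] at *
  linarith [dist_triangle x.toL1 y.toL1 z.toL1]

theorem le_antisymm {x y : AffineForm} (hxy : x.le y) (hyx : y.le x) : x = y := by
  rw [le_iff] at *
  have hβ : x.β = y.β := by
    linarith [dist_nonneg (x := x.toL1) (y := y.toL1), dist_nonneg (x := y.toL1) (y := x.toL1)]
  have hα : x.toL1 = y.toL1 := dist_le_zero.1 (by linarith)
  rw [← ofL1_toL1 x, hα, hβ, ofL1_toL1]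

theorem β_le_of_le {x y : AffineForm} (h : x.le y) : x.β ≤ y.β := by
  rw [le_iff] at h
  linarith [dist_nonneg (x := x.toL1) (y := y.toL1)]

theorem dist_le_abs_of_le_or_le {x y : AffineForm} (h : x.le y ∨ y.le x) :
    dist x.toL1 y.toL1 ≤ |x.β - y.β| := by
  rcases h with h | h <;> rw [le_iff] at h
  · exact h.trans (by rw [abs_sub_comm]; exact le_abs_self _)
  · rw [dist_comm]
    exact h.trans (le_abs_self _)

/-- A nonempty chain that is bounded below has a lower bound which lies above every
lower bound of the chain. -/
theorem exists_isGLB_of_chain {c : Set AffineForm} (hne : c.Nonempty)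
    (hc : ∀ x ∈ c, ∀ y ∈ c, x.le y ∨ y.le x) {l : AffineForm} (hl : ∀ x ∈ c, l.le x) :
    ∃ z : AffineForm, (∀ x ∈ c, z.le x) ∧ ∀ a : AffineForm, (∀ x ∈ c, a.le x) → a.le z := by
  have hglb : IsGLB (β '' c) (sInf (β '' c)) := by
    refine isGLB_csInf (hne.image _) ⟨l.β, ?_⟩
    rintro _ ⟨x, hx, rfl⟩
    exact β_le_of_le (hl x hx)
  obtain ⟨u, -, -, hu, humem⟩ := hglb.exists_seq_antitone_tendsto (hne.image _)
  choose s hs hsu using humem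
  have hβ : Filter.Tendsto (fun n => (s n).β) Filter.atTop (nhds (sInf (β '' c))) := by
    simpa only [hsu] using hu
  have hcauchy : CauchySeq fun n => (s n).toL1 := by
    rw [Metric.cauchySeq_iff]
    intro ε hε
    obtain ⟨N, hN⟩ := Metric.cauchySeq_iff.1 hβ.cauchySeq ε hε
    exact ⟨N, fun m hm n hn =>
      (dist_le_abs_of_le_or_le (hc _ (hs m) _ (hs n))).trans_lt (hN m hm n hn)⟩
  obtain ⟨f, hf⟩ := cauchySeq_tendsto_of_complete hcauchy
  refine ⟨ofL1 f (sInf (β '' c)), fun x hx => ?_, fun a ha => ?_⟩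
  · rw [le_iff, toL1_ofL1]
    have hlim := le_of_tendsto_of_tendsto' (hf.dist tendsto_const_nhds)
      (hβ.sub tendsto_const_nhds).abs
      fun n => dist_le_abs_of_le_or_le (hc _ (hs n) _ hx)
    rwa [abs_sub_comm, abs_of_nonneg (sub_nonneg.2 (hglb.1 ⟨x, hx, rfl⟩))] at hlim
  · rw [le_iff, toL1_ofL1]
    exact le_of_tendsto_of_tendsto' (tendsto_const_nhds.dist hf) (hβ.sub tendsto_const_nhds)
      fun n => (le_iff _ _).1 (ha _ (hs n))

/-- Quasi bounded completeness of `(𝔸₁, ≤)`: every nonempty subset that is bounded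
above and whose elements pairwise satisfy `‖αˣ - αʸ‖₁ ≥ |βˣ - βʸ|` admits a minimal
upper bound. -/
theorem quasi_bounded_complete (A : Set AffineForm) (hne : A.Nonempty)
    (hbdd : ∃ b, ∀ a ∈ A, a.le b)
    (hcond : ∀ x ∈ A, ∀ y ∈ A, |x.β - y.β| ≤ distL x y) :
    ∃ z, (∀ a ∈ A, a.le z) ∧ ∀ w, (∀ a ∈ A, a.le w) → w.le z → w = z := by
  obtain ⟨b, hb⟩ := hbdd
  obtain ⟨a₀, ha₀⟩ := hne
  let U := {x : AffineForm // ∀ a ∈ A, a.le x}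
  obtain ⟨m, hm⟩ : ∃ m : U, ∀ w : U, w.1.le m.1 → m.1.le w.1 := by
    refine exists_maximal_of_chains_bounded (r := fun x y : U => y.1.le x.1) (fun c hc => ?_)
      fun hxy hyz => le_trans hyz hxy
    rcases c.eq_empty_or_nonempty with rfl | hcne
    · exact ⟨⟨b, hb⟩, by simp⟩
    · have hchain : ∀ x ∈ Subtype.val '' c, ∀ y ∈ Subtype.val '' c, x.le y ∨ y.le x := by
        rintro _ ⟨x, hx, rfl⟩ _ ⟨y, hy, rfl⟩
        rcases eq_or_ne x y with rfl | hxy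
        · exact Or.inl (le_refl _)
        · exact (hc hx hy hxy).symm
      have hlower : ∀ a ∈ A, ∀ x ∈ Subtype.val '' c, a.le x := by
        rintro a ha _ ⟨x, -, rfl⟩
        exact x.2 a ha
      obtain ⟨z, hz, hz'⟩ := exists_isGLB_of_chain (hcne.image _) hchain (hlower a₀ ha₀)
      exact ⟨⟨z, fun a ha => hz' a (hlower a ha)⟩, fun x hx => hz _ ⟨x, hx, rfl⟩⟩
  exact ⟨m.1, m.2, fun w hw hwm => le_antisymm hwm (hm ⟨w, hw⟩ hwm)⟩

end AffineForm
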